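/- Let S be a compact metric space and θ a Borel probability measure on S. There exists exactly one Borel probability measure π on S that is stationary for the kernel K^{θ,2,2}, i.e. satisfying π(A) = ∫_S K^{θ,2,2}(x,A) π(dx) for every Borel set A ⊆ S. -/

import Mathlib

open MeasureTheory
open scoped ENNReal

/-- The transition kernel `K^{θ,2,2}(x,A)`: step to the farther of two i.i.d. `θ`-samples,
ties broken uniformly. -/
noncomputable def K22 {S : Type*} [MetricSpace S] [MeasurableSpace S]
    (θ : Measure S) (x : S) (A : Set S) : ℝ≥0∞ :=
  ∫⁻ y in A, (2 * θ {z | dist x z < dist x y} + θ {z | dist x z = dist x y}) ∂θ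

namespace ProbabilityTheory.Kernel

variable {α : Type*} [MeasurableSpace α]

/-- The remainder `κ - ν` of a kernel minorized by a finite measure `ν`. -/
noncomputable def subMeasure (κ : Kernel α α) (ν : Measure α) [IsFiniteMeasure ν]
    (h : ∀ x, ν ≤ κ x) : Kernel α α where
  toFun x := κ x - ν
  measurable' := by
    refine Measure.measurable_of_measurable_coe _ fun s hs => ?_
    simp_rw [Measure.sub_apply hs (h _)]
    exact (κ.measurable_coe hs).sub_const _

theorem apply_eq_subMeasure_add (κ : Kernel α α) (ν : Measure α) [IsFiniteMeasure ν]
    (h : ∀ x, ν ≤ κ x) (x : α) (s : Set α) : κ x s = ν s + subMeasure κ ν h x s := by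
  have h1 : κ x - ν + ν = κ x := Measure.sub_add_cancel_of_le (h x)
  rw [add_comm]
  exact (DFunLike.congr_fun h1 s).symm

/-- Under a Doeblin minorization by a nonzero measure, a Markov kernel has exactly one invariant
probability measure. -/
theorem existsUnique_bind_eq_of_le (κ : Kernel α α) [IsMarkovKernel κ] (ν : Measure α)
    [IsFiniteMeasure ν] (hν : ν ≠ 0) (h : ∀ x, ν ≤ κ x) :
    ∃! π : Measure α, IsProbabilityMeasure π ∧ π.bind κ = π := by
  set R := subMeasure κ ν h
  have hκ : ∀ (μ : Measure α) {s : Set α}, MeasurableSet s →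
      (μ.bind κ) s = ν s * μ .univ + ∫⁻ x, R x s ∂μ := by
    intro μ s hs
    rw [Measure.bind_apply hs κ.aemeasurable]
    simp_rw [apply_eq_subMeasure_add κ ν h]
    rw [lintegral_add_left measurable_const, MeasureTheory.lintegral_const]
  let m : ℕ → Measure α := fun n => Nat.rec ν (fun _ μ => μ.bind R) n
  have hm0 : m 0 = ν := rfl
  have hm : ∀ (n : ℕ) {s : Set α}, MeasurableSet s → m (n + 1) s = ∫⁻ x, R x s ∂(m n) :=
    fun n s hs => Measure.bind_apply hs R.aemeasurable
  have hν1 : ν .univ ≤ 1 := by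
    obtain ⟨x⟩ : Nonempty α := by
      by_contra hne
      rw [not_nonempty_iff] at hne
      exact hν (Subsingleton.elim _ _)
    simpa using h x .univ
  have hRuniv : ∀ x, R x .univ = 1 - ν .univ := by
    intro x
    refine ENNReal.eq_sub_of_add_eq (measure_ne_top ν _) ?_
    rw [add_comm, ← apply_eq_subMeasure_add κ ν h, measure_univ]
  have hmuniv : ∀ n, m n .univ = ν .univ * (1 - ν .univ) ^ n := by
    intro n
    induction n with
    | zero => simp [hm0]
    | succ n ih =>
      rw [hm n .univ]
      simp_rw [hRuniv]
      rw [MeasureTheory.lintegral_const, ih, pow_succ]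
      ring
  have hprob : IsProbabilityMeasure (Measure.sum m) := by
    constructor
    rw [Measure.sum_apply _ .univ]
    simp_rw [hmuniv]
    rw [ENNReal.tsum_mul_left, ENNReal.tsum_geometric,
      ENNReal.sub_sub_cancel ENNReal.one_ne_top hν1]
    exact ENNReal.mul_inv_cancel (by simpa using hν) (measure_ne_top _ _)
  refine ⟨Measure.sum m, ⟨hprob, ?_⟩, ?_⟩
  · ext s hs
    rw [hκ _ hs, measure_univ, mul_one, lintegral_sum_measure, Measure.sum_apply _ hs,
      tsum_eq_zero_add' (f := fun i => m i s) ENNReal.summable]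
    exact congrArg (ν s + ·) (tsum_congr fun n => (hm n hs).symm)
  · rintro μ ⟨hμ, hinv⟩
    have key : ∀ n, ∑ i ∈ Finset.range n, m i ≤ μ := by
      intro n
      induction n with
      | zero => simpa using Measure.zero_le μ
      | succ n ih =>
        refine Measure.le_iff.2 fun s hs => ?_
        rw [← hinv, hκ _ hs, measure_univ, mul_one, Measure.finsetSum_apply,
          Finset.sum_range_succ', add_comm, hm0]
        simp_rw [hm _ hs]
        rw [← lintegral_finsetSum_measure]
        gcongr
    refine (Measure.eq_of_le_of_isProbabilityMeasure (Measure.le_iff.2 fun s hs => ?_)).symm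
    rw [Measure.sum_apply _ hs, ENNReal.tsum_eq_iSup_nat]
    refine iSup_le fun n => ?_
    rw [← Measure.finsetSum_apply]
    exact key n s

/-- If the two-step kernel has exactly one invariant probability measure, so does the kernel. -/
theorem existsUnique_bind_eq_of_comp_self (κ : Kernel α α) [IsMarkovKernel κ]
    (h : ∃! π : Measure α, IsProbabilityMeasure π ∧ π.bind (κ ∘ₖ κ) = π) :
    ∃! π : Measure α, IsProbabilityMeasure π ∧ π.bind κ = π := by
  have hcomp : ∀ μ : Measure α, μ.bind (κ ∘ₖ κ) = (μ.bind κ).bind κ :=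
    fun μ => Measure.comp_assoc.symm
  obtain ⟨π, ⟨hπ, hinv⟩, huniq⟩ := h
  refine ⟨π, ⟨hπ, huniq _ ⟨inferInstance, ?_⟩⟩, ?_⟩
  · rw [hcomp, ← hcomp π, hinv]
  · rintro μ ⟨hμ, hμinv⟩
    exact huniq μ ⟨hμ, by rw [hcomp, hμinv, hμinv]⟩

end ProbabilityTheory.Kernel

section FartherSample

open ProbabilityTheory

/-- The rank function of a real-valued map under `μ` has total integral `μ univ ^ 2`. -/
theorem lintegral_two_mul_measure_lt_add_measure_eq {α : Type*} [MeasurableSpace α]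
    (μ : Measure α) [IsFiniteMeasure μ] {g : α → ℝ} (hg : Measurable g) :
    ∫⁻ y, (2 * μ {z | g z < g y} + μ {z | g z = g y}) ∂μ = μ .univ * μ .univ := by
  have hlt : MeasurableSet {p : α × α | g p.2 < g p.1} :=
    measurableSet_lt (hg.comp measurable_snd) (hg.comp measurable_fst)
  have heq : MeasurableSet {p : α × α | g p.2 = g p.1} :=
    measurableSet_eq_fun (hg.comp measurable_snd) (hg.comp measurable_fst)
  have mlt : Measurable fun y => μ {z | g z < g y} := measurable_measure_prodMk_left hlt
  have meq : Measurable fun y => μ {z | g z = g y} := measurable_measure_prodMk_left heq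
  have mgt : Measurable fun y => μ {z | g y < g z} := measurable_measure_prodMk_right hlt
  have hsymm : ∫⁻ y, μ {z | g z < g y} ∂μ = ∫⁻ y, μ {z | g y < g z} ∂μ :=
    (Measure.prod_apply (μ := μ) (ν := μ) hlt).symm.trans (Measure.prod_apply_symm hlt)
  have htri : ∀ y, μ {z | g z < g y} + μ {z | g y < g z} + μ {z | g z = g y} = μ .univ := by
    intro y
    have h1 : MeasurableSet {z | g y < g z} := measurableSet_lt measurable_const hg
    have h2 : MeasurableSet {z | g z = g y} := measurableSet_eq_fun hg measurable_const
    rw [← measure_union _ h1, ← measure_union _ h2]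
    · congr 1
      ext z
      rcases lt_trichotomy (g z) (g y) with h | h | h <;> simp [h]
    · rw [Set.disjoint_left]
      rintro z (h | h) h' <;> simp only [Set.mem_ofPred_eq] at h h' <;> linarith
    · rw [Set.disjoint_left]
      intro z h h'
      simp only [Set.mem_ofPred_eq] at h h'
      linarith
  calc ∫⁻ y, (2 * μ {z | g z < g y} + μ {z | g z = g y}) ∂μ
      = ∫⁻ y, (μ {z | g z < g y} + μ {z | g y < g z} + μ {z | g z = g y}) ∂μ := by
        rw [lintegral_add_right _ meq, lintegral_add_right _ meq, lintegral_add_left mlt,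
          lintegral_const_mul _ mlt, ← hsymm, two_mul]
    _ = μ .univ * μ .univ := by simp_rw [htri]; rw [lintegral_const]

variable {S : Type*} [MetricSpace S] [MeasurableSpace S]

/-- The density of `K22 θ x` with respect to `θ`. -/
noncomputable def fartherDensity (θ : Measure S) (x y : S) : ℝ≥0∞ :=
  2 * θ {z | dist x z < dist x y} + θ {z | dist x z = dist x y}

variable [CompactSpace S] [BorelSpace S] (θ : Measure S) [IsProbabilityMeasure θ]

theorem measurable_uncurry_fartherDensity :
    Measurable (Function.uncurry (fartherDensity θ)) := by
  have h1 : Measurable fun p : (S × S) × S => dist p.1.1 p.2 := by fun_prop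
  have h2 : Measurable fun p : (S × S) × S => dist p.1.1 p.1.2 := by fun_prop
  exact ((measurable_measure_prodMk_left (measurableSet_lt h1 h2)).const_mul 2).add
    (measurable_measure_prodMk_left (measurableSet_eq_fun h1 h2))

theorem measurable_fartherDensity (x : S) : Measurable (fartherDensity θ x) :=
  (measurable_uncurry_fartherDensity θ).of_uncurry_left

theorem lintegral_fartherDensity (x : S) : ∫⁻ y, fartherDensity θ x y ∂θ = 1 := by
  have := lintegral_two_mul_measure_lt_add_measure_eq θ (g := dist x) (by fun_prop)
  simpa [fartherDensity] using this

/-- The set of target points at which the density is below `c` has measure at most `c`. -/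
theorem measure_fartherDensity_lt_le (x : S) (c : ℝ≥0∞) :
    θ {y | fartherDensity θ x y < c} ≤ c := by
  set B := {y | fartherDensity θ x y < c}
  have hBm : MeasurableSet B := measurableSet_lt (measurable_fartherDensity θ x) measurable_const
  have h1 := lintegral_two_mul_measure_lt_add_measure_eq (θ.restrict B) (g := dist x) (by fun_prop)
  rw [Measure.restrict_apply_univ] at h1
  have h2 : θ B * θ B ≤ c * θ B := by
    rw [← h1]
    calc _ ≤ ∫⁻ y in B, fartherDensity θ x y ∂θ := by
          refine lintegral_mono fun y => ?_
          unfold fartherDensity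
          gcongr <;> exact Measure.restrict_le_self
      _ ≤ ∫⁻ _ in B, c ∂θ := setLIntegral_mono measurable_const fun y hy => le_of_lt hy
      _ = c * θ B := by simp
  by_cases h0 : θ B = 0
  · simp [h0]
  · exact (ENNReal.mul_le_mul_iff_left h0 (measure_ne_top _ _)).1 h2

/-- `K22 θ` as a kernel. -/
noncomputable def fartherKernel : Kernel S S :=
  Kernel.withDensity (Kernel.const S θ) (fartherDensity θ)

theorem fartherKernel_apply (x : S) :
    fartherKernel θ x = θ.withDensity (fartherDensity θ x) := by
  rw [fartherKernel, Kernel.withDensity_apply _ (measurable_uncurry_fartherDensity θ),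
    Kernel.const_apply]

theorem fartherKernel_apply_eq_K22 (x : S) {A : Set S} (hA : MeasurableSet A) :
    fartherKernel θ x A = K22 θ x A := by
  rw [fartherKernel_apply, withDensity_apply _ hA]
  rfl

instance : IsMarkovKernel (fartherKernel θ) where
  isProbabilityMeasure x := ⟨by
    rw [fartherKernel_apply, withDensity_apply _ .univ, setLIntegral_univ,
      lintegral_fartherDensity]⟩

/-- The density of a measure minorizing the two-step kernel, for a threshold `c`. -/
noncomputable def twoStepMinorant (c : ℝ≥0∞) (z : S) : ℝ≥0∞ :=
  c * c * (θ {y | c ≤ fartherDensity θ y z} - c)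

theorem measurable_measure_le_fartherDensity (c : ℝ≥0∞) :
    Measurable fun z => θ {y | c ≤ fartherDensity θ y z} :=
  measurable_measure_prodMk_right (μ := θ)
    (measurableSet_le measurable_const (measurable_uncurry_fartherDensity θ))

theorem twoStepMinorant_le (c : ℝ≥0∞) (x z : S) :
    twoStepMinorant θ c z ≤ ∫⁻ y, fartherDensity θ x y * fartherDensity θ y z ∂θ := by
  have hmeas : Measurable fun y => fartherDensity θ x y * fartherDensity θ y z :=
    (measurable_fartherDensity θ x).mul (measurable_uncurry_fartherDensity θ).of_uncurry_right
  refine le_trans ?_ (mul_meas_ge_le_lintegral hmeas (c * c))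
  unfold twoStepMinorant
  gcongr
  calc θ {y | c ≤ fartherDensity θ y z} - c
      ≤ θ {y | c ≤ fartherDensity θ y z} - θ {y | fartherDensity θ x y < c} :=
        tsub_le_tsub_left (measure_fartherDensity_lt_le θ x c) _
    _ ≤ θ ({y | c ≤ fartherDensity θ y z} \ {y | fartherDensity θ x y < c}) := le_measure_sdiff
    _ ≤ _ := by
        refine measure_mono fun y hy => ?_
        exact mul_le_mul' (not_lt.1 fun h => hy.2 h) (show c ≤ fartherDensity θ y z from hy.1)

theorem withDensity_twoStepMinorant_le (c : ℝ≥0∞) (x : S) :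
    θ.withDensity (twoStepMinorant θ c) ≤ (fartherKernel θ ∘ₖ fartherKernel θ) x := by
  have hf := measurable_uncurry_fartherDensity θ
  refine Measure.le_iff.2 fun A hA => ?_
  have hprod : Measurable (Function.uncurry fun y z =>
      fartherDensity θ x y * fartherDensity θ y z) :=
    ((measurable_fartherDensity θ x).comp measurable_fst).mul hf
  rw [withDensity_apply _ hA, Kernel.comp_apply' _ _ _ hA, fartherKernel_apply,
    lintegral_withDensity_eq_lintegral_mul _ (measurable_fartherDensity θ x)
      ((fartherKernel θ).measurable_coe hA)]
  calc _ ≤ ∫⁻ z in A, ∫⁻ y, fartherDensity θ x y * fartherDensity θ y z ∂θ ∂θ :=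
        lintegral_mono fun z => twoStepMinorant_le θ c x z
    _ = ∫⁻ y, ∫⁻ z in A, fartherDensity θ x y * fartherDensity θ y z ∂θ ∂θ :=
        (lintegral_lintegral_swap hprod.aemeasurable).symm
    _ = _ := by
        refine lintegral_congr fun y => ?_
        rw [lintegral_const_mul _ (measurable_fartherDensity θ y), Pi.mul_apply,
          fartherKernel_apply, withDensity_apply _ hA]

theorem withDensity_twoStepMinorant_ne_zero :
    θ.withDensity (twoStepMinorant θ 4⁻¹) ≠ 0 := by
  intro h0
  have hm := measurable_measure_le_fartherDensity θ 4⁻¹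
  have hmin : Measurable (twoStepMinorant θ 4⁻¹) := (hm.sub_const _).const_mul _
  rw [withDensity_eq_zero_iff hmin.aemeasurable] at h0
  have hle : ∫⁻ z, θ {y | 4⁻¹ ≤ fartherDensity θ y z} ∂θ ≤ 4⁻¹ := by
    calc _ ≤ ∫⁻ _, 4⁻¹ ∂θ := by
          refine lintegral_mono_ae ?_
          filter_upwards [h0] with z hz
          simpa [twoStepMinorant, tsub_eq_zero_iff_le] using hz
      _ = 4⁻¹ := by simp
  have hset : MeasurableSet {p : S × S | 4⁻¹ ≤ fartherDensity θ p.1 p.2} :=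
    measurableSet_le measurable_const (measurable_uncurry_fartherDensity θ)
  have hswap : ∫⁻ z, θ {y | 4⁻¹ ≤ fartherDensity θ y z} ∂θ
      = ∫⁻ y, θ {z | 4⁻¹ ≤ fartherDensity θ y z} ∂θ :=
    (Measure.prod_apply_symm (μ := θ) (ν := θ) hset).symm.trans (Measure.prod_apply hset)
  have hge : ∀ y, 1 - 4⁻¹ ≤ θ {z | 4⁻¹ ≤ fartherDensity θ y z} := by
    intro y
    have hB : MeasurableSet {z | fartherDensity θ y z < 4⁻¹} :=
      measurableSet_lt (measurable_fartherDensity θ y) measurable_const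
    have hc : {z | 4⁻¹ ≤ fartherDensity θ y z} = {z | fartherDensity θ y z < 4⁻¹}ᶜ := by
      ext z
      simp
    rw [hc, prob_compl_eq_one_sub hB]
    exact tsub_le_tsub_left (measure_fartherDensity_lt_le θ y _) _
  have hlow : (1 : ℝ≥0∞) - 4⁻¹ ≤ 4⁻¹ := by
    calc (1 : ℝ≥0∞) - 4⁻¹ = ∫⁻ _, (1 - 4⁻¹) ∂θ := by simp
      _ ≤ _ := lintegral_mono hge
      _ ≤ 4⁻¹ := hswap ▸ hle
  have h1 : (1 : ℝ≥0∞) ≤ 4⁻¹ + 4⁻¹ := tsub_le_iff_right.1 hlow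
  have h2 := ENNReal.toReal_mono (by simp) h1
  rw [ENNReal.toReal_add (by simp) (by simp)] at h2
  norm_num at h2

end FartherSample

theorem stmt_5 {S : Type*} [MetricSpace S] [CompactSpace S] [MeasurableSpace S] [BorelSpace S]
    (θ : Measure S) [IsProbabilityMeasure θ] :
    ∃! π : Measure S, IsProbabilityMeasure π ∧
      ∀ A : Set S, MeasurableSet A → π A = ∫⁻ x, K22 θ x A ∂π := by
  have hle := withDensity_twoStepMinorant_le θ 4⁻¹
  obtain ⟨x⟩ : Nonempty S := nonempty_of_isProbabilityMeasure θ
  have : IsFiniteMeasure (θ.withDensity (twoStepMinorant θ 4⁻¹)) :=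
    isFiniteMeasure_of_le _ (hle x)
  have huniq := ProbabilityTheory.Kernel.existsUnique_bind_eq_of_comp_self (fartherKernel θ)
    (ProbabilityTheory.Kernel.existsUnique_bind_eq_of_le _ _
      (withDensity_twoStepMinorant_ne_zero θ) hle)
  have hiff : ∀ π : Measure S, π.bind (fartherKernel θ) = π ↔
      ∀ A : Set S, MeasurableSet A → π A = ∫⁻ x, K22 θ x A ∂π := by
    intro π
    rw [Measure.ext_iff]
    refine forall₂_congr fun A hA => ?_
    rw [Measure.bind_apply hA (fartherKernel θ).aemeasurable, eq_comm]
    simp_rw [fartherKernel_apply_eq_K22 θ _ hA]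
  simpa only [hiff] using huniq
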